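/- Let χ be a character of T of minimal depth r, and for each integer d ≥ r+1 let W_d be a K-invariant complement of V_χ^{K_d} in V_χ^{K_{d+1}}. Then the K-representations V_χ^{K_{r+1}} and W_d (d ≥ r+1) are pairwise non-isomorphic; in particular, the decomposition ⋃_{n ≥ r+1} V_χ^{K_n} = V_χ^{K_{r+1}} ⊕ ⊕_{d ≥ r+1} W_d is multiplicity-free. -/

import Mathlib

open Matrix

noncomputable section

/-- A 2×2 matrix over `E`. -/
abbrev Mat (E : Type) := Matrix (Fin 2) (Fin 2) E

/-- The context: `E/F` is the unramified quadratic extension of a finite extension `F` of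
`ℚ_p` (`p` odd), encoded via the Galois involution `sig` (whose fixed field is `F`),
the valuation `nu` (normalized by `nu ϖ = 1` for a uniformizer `ϖ` of `F`),
a square root `sqeps` of a non-square unit `eps = sqeps^2` of `O_F`, the residue-field
cardinality `q` of `F`, and an additive character `psi'` of `F` trivial on `p_F` and
nontrivial on `O_F`. -/
structure USetting (E : Type) [Field E] where
  sig : E →+* E
  nu : E → WithTop ℤ
  sqeps : E
  pi : E
  q : ℕ
  psi' : E → ℂ
  sig_invol : ∀ x, sig (sig x) = x
  sig_ne : ∃ x, sig x ≠ x
  nu_eq_top : ∀ x, nu x = ⊤ ↔ x = 0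
  nu_mul : ∀ x y, nu (x * y) = nu x + nu y
  nu_add : ∀ x y, min (nu x) (nu y) ≤ nu (x + y)
  nu_sig : ∀ x, nu (sig x) = nu x
  nu_pi : nu pi = 1
  sig_pi : sig pi = pi
  sig_sqeps : sig sqeps = - sqeps
  nu_sqeps : nu sqeps = 0
  eps_not_square : ∀ y, sig y = y → y * y ≠ sqeps * sqeps
  gen : ∀ x : E, ∃ a b, sig a = a ∧ sig b = b ∧ x = a + b * sqeps
  nu_two : nu 2 = 0
  charzero : ∀ n : ℕ, (n : E) = 0 → n = 0
  complete : ∀ f : ℕ → E, (∀ n : ℕ, ((n : ℤ) : WithTop ℤ) ≤ nu (f (n + 1) - f n)) →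
    ∃ L, ∀ n : ℕ, ((n : ℤ) : WithTop ℤ) ≤ nu (L - f n)
  res_card : ∃ R : Finset E, R.card = q ∧ (∀ x ∈ R, sig x = x ∧ 0 ≤ nu x) ∧
    ∀ y : E, sig y = y → 0 ≤ nu y → ∃! x, x ∈ R ∧ 1 ≤ nu (y - x)
  psi'_mul : ∀ x y, sig x = x → sig y = y → psi' (x + y) = psi' x * psi' y
  psi'_ne : ∀ x, sig x = x → psi' x ≠ 0
  psi'_triv : ∀ x, sig x = x → 1 ≤ nu x → psi' x = 1
  psi'_nontriv : ∃ x, sig x = x ∧ 0 ≤ nu x ∧ psi' x ≠ 1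

variable {E : Type} [Field E]

/-- The matrix `w₀ = [[0,1],[1,0]]`. -/
def w0 (E : Type) [Field E] : Mat E := !![0, 1; 1, 0]

/-- `G = U(1,1)(F)`. -/
def Gset (S : USetting E) : Set (Mat E) :=
  {g | (g.map ⇑S.sig)ᵀ * w0 E * g = w0 E}

/-- `K = G ∩ GL₂(O_E)`: entries in `O_E` and determinant in `O_E^×`. -/
def Kset (S : USetting E) : Set (Mat E) :=
  {g | g ∈ Gset S ∧ (∀ i j, 0 ≤ S.nu (g i j)) ∧ S.nu g.det = 0}

/-- The congruence filtration subgroup `K_n` (for `n ≥ 1`; `K_0 = K` as a set). -/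
def Kfil (S : USetting E) (n : ℤ) : Set (Mat E) :=
  {g | g ∈ Kset S ∧ ∀ i j, (n : WithTop ℤ) ≤ S.nu ((g - 1) i j)}

/-- `𝓑 = B ∩ K`, the upper triangular matrices in `K`. -/
def Bcal (S : USetting E) : Set (Mat E) := {g | g ∈ Kset S ∧ g 1 0 = 0}

/-- `E^1`, the norm-one elements of `E`. -/
def E1set (S : USetting E) : Set E := {x | x * S.sig x = 1}

/-- `O_F^×` as a subset of `E`. -/
def OFunits (S : USetting E) : Set E := {x | S.sig x = x ∧ S.nu x = 0}

/-- `O_E^×` as a subset of `E`. -/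
def OEunits (S : USetting E) : Set E := {x | S.nu x = 0}

/-- A character of `E^×`, encoded as a function `E → ℂ` multiplicative and
nonvanishing on nonzero elements. -/
def IsChar (χ : E → ℂ) : Prop :=
  (∀ x y : E, x ≠ 0 → y ≠ 0 → χ (x * y) = χ x * χ y) ∧ ∀ x : E, x ≠ 0 → χ x ≠ 0

/-- A group homomorphism `E^1 → ℂ^×`, encoded as a function `E → ℂ`. -/
def IsE1Hom (S : USetting E) (φ : E → ℂ) : Prop :=
  (∀ x ∈ E1set S, ∀ y ∈ E1set S, φ (x * y) = φ x * φ y) ∧ ∀ x ∈ E1set S, φ x ≠ 0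

/-- A homomorphism into `ℂ^×` on a subset of matrices. -/
def IsHomOn (A : Set (Mat E)) (Ψ : Mat E → ℂ) : Prop :=
  (∀ x ∈ A, ∀ y ∈ A, Ψ (x * y) = Ψ x * Ψ y) ∧ ∀ x ∈ A, Ψ x ≠ 0

/-- `1 + p_E^n`. -/
def onePE (S : USetting E) (n : ℤ) : Set E := {x | (n : WithTop ℤ) ≤ S.nu (x - 1)}

/-- `1 + p_F^n`. -/
def onePF (S : USetting E) (n : ℤ) : Set E :=
  {x | S.sig x = x ∧ (n : WithTop ℤ) ≤ S.nu (x - 1)}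

/-- `χ` is trivial on a set. -/
def TrivOn (χ : E → ℂ) (s : Set E) : Prop := ∀ x ∈ s, χ x = 1

/-- `χ` has depth `r`: trivial on `1+p_E^{r+1}` and (if `r ≥ 1`) nontrivial on `1+p_E^r`. -/
def HasDepth (S : USetting E) (χ : E → ℂ) (r : ℕ) : Prop :=
  TrivOn χ (onePE S ((r : ℤ) + 1)) ∧ (r = 0 ∨ ¬ TrivOn χ (onePE S (r : ℤ)))

/-- `χ` has true depth `r`: the depth of its restriction to `F^×` is `r`. -/
def HasTrueDepth (S : USetting E) (χ : E → ℂ) (r : ℕ) : Prop :=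
  TrivOn χ (onePF S ((r : ℤ) + 1)) ∧ (r = 0 ∨ ¬ TrivOn χ (onePF S (r : ℤ)))

/-- `χ` has minimal depth `r`: its depth and true depth both equal `r`. -/
def MinDepth (S : USetting E) (χ : E → ℂ) (r : ℕ) : Prop :=
  HasDepth S χ r ∧ HasTrueDepth S χ r

/-- Right translation action on functions. -/
def rho (g : Mat E) : (Mat E → ℂ) →ₗ[ℂ] (Mat E → ℂ) where
  toFun f := fun k => f (k * g)
  map_add' _ _ := rfl
  map_smul' _ _ := rfl

/-- The space `V_χ^{K_n}`: functions on `K` (extended by zero off `K`) satisfying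
`f(bk) = χ(b₁₁) f(k)` for `b ∈ 𝓑` and right `K_n`-invariance. -/
def Vsp (S : USetting E) (χ : E → ℂ) (n : ℤ) : Submodule ℂ (Mat E → ℂ) where
  carrier := {f | (∀ x, x ∉ Kset S → f x = 0) ∧
    (∀ b ∈ Bcal S, ∀ k ∈ Kset S, f (b * k) = χ (b 0 0) * f k) ∧
    (∀ k ∈ Kset S, ∀ g ∈ Kfil S n, f (k * g) = f k)}
  add_mem' := by
    rintro f g ⟨hf0, hf1, hf2⟩ ⟨hg0, hg1, hg2⟩
    refine ⟨fun x hx => ?_, fun b hb k hk => ?_, fun k hk g' hg' => ?_⟩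
    · simp [hf0 x hx, hg0 x hx]
    · simp only [Pi.add_apply, hf1 b hb k hk, hg1 b hb k hk]; ring
    · simp only [Pi.add_apply, hf2 k hk g' hg', hg2 k hk g' hg']
  zero_mem' := by
    refine ⟨fun x _ => rfl, fun b _ k _ => by simp, fun k _ g _ => rfl⟩
  smul_mem' := by
    rintro c f ⟨hf0, hf1, hf2⟩
    refine ⟨fun x hx => ?_, fun b hb k hk => ?_, fun k hk g' hg' => ?_⟩
    · simp [hf0 x hx]
    · simp only [Pi.smul_apply, hf1 b hb k hk, smul_eq_mul]; ring
    · simp only [Pi.smul_apply, hf2 k hk g' hg']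

/-- The space of the representation induced from a character `Ψ` of a subgroup `H ⊆ K`:
functions on `K` (extended by zero) with `f(hk) = Ψ(h) f(k)`. -/
def IndSp (S : USetting E) (H : Set (Mat E)) (Ψ : Mat E → ℂ) : Submodule ℂ (Mat E → ℂ) where
  carrier := {f | (∀ x, x ∉ Kset S → f x = 0) ∧
    ∀ h ∈ H, ∀ k ∈ Kset S, f (h * k) = Ψ h * f k}
  add_mem' := by
    rintro f g ⟨hf0, hf1⟩ ⟨hg0, hg1⟩
    refine ⟨fun x hx => ?_, fun h hh k hk => ?_⟩
    · simp [hf0 x hx, hg0 x hx]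
    · simp only [Pi.add_apply, hf1 h hh k hk, hg1 h hh k hk]; ring
  zero_mem' := ⟨fun x _ => rfl, fun h _ k _ => by simp⟩
  smul_mem' := by
    rintro c f ⟨hf0, hf1⟩
    refine ⟨fun x hx => ?_, fun h hh k hk => ?_⟩
    · simp [hf0 x hx]
    · simp only [Pi.smul_apply, hf1 h hh k hk, smul_eq_mul]; ring

/-- The functions constant on `K` and zero off `K`. -/
def ConstSub (S : USetting E) : Submodule ℂ (Mat E → ℂ) where
  carrier := {f | (∀ x, x ∉ Kset S → f x = 0) ∧ ∃ c : ℂ, ∀ k ∈ Kset S, f k = c}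
  add_mem' := by
    rintro f g ⟨hf0, c, hc⟩ ⟨hg0, c', hc'⟩
    exact ⟨fun x hx => by simp [hf0 x hx, hg0 x hx],
      c + c', fun k hk => by simp [hc k hk, hc' k hk]⟩
  zero_mem' := ⟨fun x _ => rfl, 0, fun _ _ => rfl⟩
  smul_mem' := by
    rintro a f ⟨hf0, c, hc⟩
    exact ⟨fun x hx => by simp [hf0 x hx], a * c, fun k hk => by simp [hc k hk]⟩

/-- A subspace is `K`-invariant. -/
def KInvariant (S : USetting E) (W : Submodule ℂ (Mat E → ℂ)) : Prop :=
  ∀ g ∈ Kset S, ∀ f ∈ W, rho g f ∈ W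

/-- A subset `A ⊆ K` acts trivially on `W`. -/
def ActsTrivially (S : USetting E) (A : Set (Mat E)) (W : Submodule ℂ (Mat E → ℂ)) : Prop :=
  ∀ g ∈ A, ∀ f ∈ W, rho g f = f

/-- `W` is an irreducible representation of `K`. -/
def IsIrredRep (S : USetting E) (W : Submodule ℂ (Mat E → ℂ)) : Prop :=
  W ≠ ⊥ ∧ KInvariant S W ∧
    ∀ U : Submodule ℂ (Mat E → ℂ), U ≤ W → KInvariant S U → U = ⊥ ∨ U = W

/-- `V` and `W` are isomorphic as representations of `K`. -/
def RepIso (S : USetting E) (V W : Submodule ℂ (Mat E → ℂ)) : Prop :=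
  ∃ e : (Mat E → ℂ) →ₗ[ℂ] (Mat E → ℂ), Set.BijOn ⇑e ↑V ↑W ∧
    ∀ g ∈ Kset S, ∀ f ∈ V, e (rho g f) = rho g (e f)

/-- The space of `ℂ`-linear endomorphisms of `V` commuting with the right-translation
action of `K`, realized inside the function space `↥V → ↥V`. -/
def Commutant (S : USetting E) (V : Submodule ℂ (Mat E → ℂ)) :
    Submodule ℂ (↥V → ↥V) where
  carrier := {T | (∀ x y : ↥V, T (x + y) = T x + T y) ∧
    (∀ (c : ℂ) (x : ↥V), T (c • x) = c • T x) ∧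
    ∀ g ∈ Kset S, ∀ f : ↥V, ∀ h : rho g (f : Mat E → ℂ) ∈ V,
      ((T ⟨rho g (f : Mat E → ℂ), h⟩ : ↥V) : Mat E → ℂ) = rho g ((T f : ↥V) : Mat E → ℂ)}
  add_mem' := by
    rintro T T' ⟨hT1, hT2, hT3⟩ ⟨hT1', hT2', hT3'⟩
    refine ⟨fun x y => ?_, fun c x => ?_, fun g hg f h => ?_⟩
    · simp only [Pi.add_apply, hT1 x y, hT1' x y]; abel
    · simp only [Pi.add_apply, hT2 c x, hT2' c x, smul_add]
    · simp only [Pi.add_apply, Submodule.coe_add, hT3 g hg f h, hT3' g hg f h, map_add]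
  zero_mem' := by
    refine ⟨fun x y => by simp, fun c x => by simp, fun g hg f h => by simp⟩
  smul_mem' := by
    rintro c T ⟨hT1, hT2, hT3⟩
    refine ⟨fun x y => ?_, fun a x => ?_, fun g hg f h => ?_⟩
    · simp only [Pi.smul_apply, hT1 x y, smul_add]
    · simp only [Pi.smul_apply, hT2 a x, smul_comm c a]
    · simp only [Pi.smul_apply, Submodule.coe_smul, hT3 g hg f h, _root_.map_smul]

/-- The additive character `ψ` of `E`, `ψ(x) = ψ'((x + σ(x))/2)`. -/
def psiE (S : USetting E) (x : E) : ℂ := S.psi' ((x + S.sig x) / 2)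

/-- `Ψ_Y(g) = ψ(Tr(Y (g − 1)))`. -/
def PsiC (S : USetting E) (Y g : Mat E) : ℂ := psiE S ((Y * (g - 1)).trace)

/-- The Lie algebra `𝔤 = 𝔲(1,1)(F)`. -/
def gfrak (S : USetting E) : Set (Mat E) :=
  {Y | (Y.map ⇑S.sig)ᵀ * w0 E + w0 E * Y = 0}

/-- The lattice `𝔨_s` of the Lie algebra, where `c = ⌈s⌉`. -/
def kfrakC (S : USetting E) (c : ℤ) : Set (Mat E) :=
  {Y | Y ∈ gfrak S ∧ (c : WithTop ℤ) ≤ S.nu (Y 0 0) ∧ (c : WithTop ℤ) ≤ S.nu (Y 1 1) ∧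
    (∃ t, S.sig t = t ∧ (c : WithTop ℤ) ≤ S.nu t ∧ Y 0 1 = S.sqeps * t) ∧
    (∃ t, S.sig t = t ∧ (c : WithTop ℤ) ≤ S.nu t ∧ Y 1 0 = S.sqeps * t)}

/-- The group `J_d`. -/
def Jgrp (S : USetting E) (d : ℕ) : Set (Mat E) :=
  {g | g ∈ Kset S ∧ ((((d + 1) / 2 : ℕ) : WithTop ℤ) ≤ S.nu (g 0 0 - 1)) ∧
    ((((d + 1) / 2 : ℕ) : WithTop ℤ) ≤ S.nu (g 0 1)) ∧
    ((((d + 1) / 2 : ℕ) : WithTop ℤ) ≤ S.nu (g 1 1 - 1)) ∧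
    (((d / 2 + 1 : ℕ) : WithTop ℤ) ≤ S.nu (g 1 0))}

/-- The centralizer `T(X)` in `K` of `X = [[z√ε, u√ε],[v√ε, z√ε]]`. -/
def TXset (S : USetting E) (u v : E) : Set (Mat E) :=
  {m | m ∈ Kset S ∧ m 1 1 = m 0 0 ∧ m 1 0 = m 0 1 * (u⁻¹ * v)}

/-- The center `Z` of `G`, identified with scalar matrices with entries in `E^1`. -/
def Zset (S : USetting E) : Set (Mat E) := {m | ∃ z ∈ E1set S, m = z • (1 : Mat E)}

/-- `𝒰 = U ∩ K`. -/
def Uset (S : USetting E) : Set (Mat E) :=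
  {m | ∃ b, S.sig b = b ∧ 0 ≤ S.nu b ∧ m = !![1, b * S.sqeps; 0, 1]}

/-- The set of products `T(X)·J_d`. -/
def TXJ (S : USetting E) (u v : E) (d : ℕ) : Set (Mat E) :=
  {x | ∃ t ∈ TXset S u v, ∃ j ∈ Jgrp S d, x = t * j}

/-- The set of products `Z·𝒰·J_d`. -/
def ZUJ (S : USetting E) (d : ℕ) : Set (Mat E) :=
  {x | ∃ z ∈ Zset S, ∃ m ∈ Uset S, ∃ j ∈ Jgrp S d, x = z * m * j}

/-- `X = [[z√ε, u√ε],[v√ε, z√ε]]`. -/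
def Xzuv (S : USetting E) (z u v : E) : Mat E :=
  !![z * S.sqeps, u * S.sqeps; v * S.sqeps, z * S.sqeps]

/-- The nilpotent element `X_δ = [[0, δ√ε],[0,0]]`. -/
def Xdelta (S : USetting E) (δ : E) : Mat E := !![0, δ * S.sqeps; 0, 0]

/-- `W` is a `K`-invariant complement of `V_χ^{K_d}` inside `V_χ^{K_{d+1}}`. -/
def Wcompl (S : USetting E) (χ : E → ℂ) (d : ℕ) (W : Submodule ℂ (Mat E → ℂ)) : Prop :=
  W ≤ Vsp S χ ((d : ℤ) + 1) ∧ KInvariant S W ∧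
    Vsp S χ (d : ℤ) ⊓ W = ⊥ ∧ Vsp S χ (d : ℤ) ⊔ W = Vsp S χ ((d : ℤ) + 1)

namespace USetting

variable (S : USetting E)

lemma nu_zero : S.nu 0 = ⊤ := (S.nu_eq_top 0).2 rfl

lemma eq_zero_of_add_self {a : WithTop ℤ} (ha : a ≠ ⊤) (h : a + a = a) : a = 0 := by
  lift a to ℤ using ha
  norm_cast at h ⊢
  omega

lemma nu_one : S.nu 1 = 0 := by
  refine eq_zero_of_add_self (fun h => one_ne_zero ((S.nu_eq_top 1).1 h)) ?_
  rw [← S.nu_mul, mul_one]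

lemma nu_neg (x : E) : S.nu (-x) = S.nu x := by
  have h1 : S.nu (-1) = 0 := by
    have h : S.nu (-1) + S.nu (-1) = 0 := by rw [← S.nu_mul]; simp [S.nu_one]
    have hne : S.nu (-1) ≠ ⊤ := fun h => by simpa using (S.nu_eq_top (-1)).1 h
    generalize S.nu (-1) = a at h hne
    lift a to ℤ using hne
    norm_cast at h ⊢
    omega
  rw [← neg_one_mul, S.nu_mul, h1, zero_add]

lemma le_nu_add {a : WithTop ℤ} {x y : E} (hx : a ≤ S.nu x) (hy : a ≤ S.nu y) :
    a ≤ S.nu (x + y) := (le_min hx hy).trans (S.nu_add x y)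

lemma le_nu_sub {a : WithTop ℤ} {x y : E} (hx : a ≤ S.nu x) (hy : a ≤ S.nu y) :
    a ≤ S.nu (x - y) := by
  rw [sub_eq_add_neg]
  exact S.le_nu_add hx (by rwa [S.nu_neg])

lemma le_nu_mul {a : WithTop ℤ} {x y : E} (hx : 0 ≤ S.nu x) (hy : a ≤ S.nu y) :
    a ≤ S.nu (x * y) := by
  rw [S.nu_mul]
  simpa using add_le_add hx hy

lemma ne_zero_of_nu_eq_zero {x : E} (hx : S.nu x = 0) : x ≠ 0 := by
  rintro rfl
  simp [S.nu_zero] at hx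

lemma nu_inv_of_nu_eq_zero {x : E} (hx : S.nu x = 0) : S.nu x⁻¹ = 0 := by
  have h := S.nu_mul x x⁻¹
  rw [mul_inv_cancel₀ (S.ne_zero_of_nu_eq_zero hx), S.nu_one, hx, zero_add] at h
  exact h.symm

/-- Two integral elements whose product differs from a unit by a non-unit are units. -/
lemma nu_eq_zero_of_mul_sub {x y z : E} (hx : 0 ≤ S.nu x) (hy : 0 ≤ S.nu y)
    (hz : 1 ≤ S.nu z) (h : S.nu (x * y - z) = 0) : S.nu x = 0 ∧ S.nu y = 0 := by
  have hxy : ¬ 1 ≤ S.nu (x * y) := fun h1 => by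
    have := S.le_nu_sub h1 hz
    rw [h] at this
    exact absurd this (by decide)
  rw [S.nu_mul] at hxy
  generalize S.nu x = a at *
  generalize S.nu y = b at *
  have ha : a ≠ ⊤ := by rintro rfl; simp at hxy
  have hb : b ≠ ⊤ := by rintro rfl; simp at hxy
  lift a to ℤ using ha
  lift b to ℤ using hb
  norm_cast at *
  omega

end USetting

lemma mul_mem_Gset_iff_left {S : USetting E} {x g : Mat E} (hg : g ∈ Gset S)
    (hdet : g.det ≠ 0) : x * g ∈ Gset S ↔ x ∈ Gset S := by
  have hmap : ((x * g).map ⇑S.sig)ᵀ * w0 E * (x * g)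
      = (g.map ⇑S.sig)ᵀ * ((x.map ⇑S.sig)ᵀ * w0 E * x) * g := by
    rw [Matrix.map_mul, Matrix.transpose_mul]
    simp only [Matrix.mul_assoc]
  have hu : IsUnit g := (Matrix.isUnit_iff_isUnit_det g).2 hdet.isUnit
  have hu' : IsUnit (g.map ⇑S.sig)ᵀ := by
    rw [Matrix.isUnit_transpose]
    exact hu.map S.sig.mapMatrix
  simp only [Gset, Set.mem_ofPred_eq] at hg ⊢
  rw [hmap]
  conv_lhs => rhs; rw [← hg]
  rw [hu.mul_left_inj, hu'.mul_right_inj]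

lemma mul_mem_Kset {S : USetting E} {x g : Mat E} (hx : x ∈ Kset S) (hg : g ∈ Kset S) :
    x * g ∈ Kset S := by
  refine ⟨(mul_mem_Gset_iff_left hg.1 (S.ne_zero_of_nu_eq_zero hg.2.2)).2 hx.1,
    fun i j => ?_, by rw [det_mul, S.nu_mul, hx.2.2, hg.2.2, add_zero]⟩
  rw [Matrix.mul_apply, Fin.sum_univ_two]
  exact S.le_nu_add (S.le_nu_mul (hx.2.1 _ _) (hg.2.1 _ _))
    (S.le_nu_mul (hx.2.1 _ _) (hg.2.1 _ _))

lemma mem_Kset_of_mul_mem {S : USetting E} {x g : Mat E} (hxg : x * g ∈ Kset S)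
    (hg : g ∈ Kset S) : x ∈ Kset S := by
  have hdet := S.ne_zero_of_nu_eq_zero hg.2.2
  refine ⟨(mul_mem_Gset_iff_left hg.1 hdet).1 hxg.1, fun i j => ?_, ?_⟩
  · have hadj : ∀ i j, 0 ≤ S.nu (g.adjugate i j) := by
      intro i j
      rw [Matrix.adjugate_fin_two]
      fin_cases i <;> fin_cases j <;> simp [S.nu_neg, hg.2.1]
    have hx : x i j = g.det⁻¹ * (x * g * g.adjugate) i j := by
      rw [Matrix.mul_assoc, Matrix.mul_adjugate]
      simp [hdet]
    rw [hx, Matrix.mul_apply, Fin.sum_univ_two]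
    exact S.le_nu_mul (S.nu_inv_of_nu_eq_zero hg.2.2).ge
      (S.le_nu_add (S.le_nu_mul (hxg.2.1 _ _) (hadj _ _)) (S.le_nu_mul (hxg.2.1 _ _) (hadj _ _)))
  · have h := hxg.2.2
    rwa [det_mul, S.nu_mul, hg.2.2, add_zero] at h

lemma one_mem_Kset (S : USetting E) : (1 : Mat E) ∈ Kset S := by
  refine ⟨by simp [Gset], fun i j => ?_, by simp [S.nu_one]⟩
  fin_cases i <;> fin_cases j <;> simp [S.nu_one, S.nu_zero]

lemma Kfil_anti (S : USetting E) {m n : ℤ} (h : m ≤ n) : Kfil S n ⊆ Kfil S m :=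
  fun _ hg => ⟨hg.1, fun i j => (WithTop.coe_le_coe.2 h).trans (hg.2 i j)⟩

lemma rho_eq_self_of_mem_Vsp {S : USetting E} {χ : E → ℂ} {n : ℤ} {f : Mat E → ℂ}
    (hf : f ∈ Vsp S χ n) {g : Mat E} (hg : g ∈ Kfil S n) : rho g f = f := by
  funext k
  change f (k * g) = f k
  by_cases hk : k ∈ Kset S
  · exact hf.2.2 k hk g hg
  · rw [hf.1 k hk, hf.1 _ fun h => hk (mem_Kset_of_mul_mem h hg.1)]

/-- Units that are congruent modulo `p_E^n` have the same value under a character which is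
trivial on `1 + p_E^n`. -/
lemma char_congr {S : USetting E} {χ : E → ℂ} (hχ : IsChar χ) {n : ℤ} (hn : 1 ≤ n)
    (htriv : TrivOn χ (onePE S n)) {x y : E} (hx : S.nu x = 0)
    (hxy : (n : WithTop ℤ) ≤ S.nu (y - x)) : χ y = χ x := by
  have hx0 := S.ne_zero_of_nu_eq_zero hx
  have hy0 : y ≠ 0 := by
    rintro rfl
    rw [zero_sub, S.nu_neg, hx] at hxy
    norm_cast at hxy
    omega
  have hmem : x⁻¹ * y ∈ onePE S n := by
    change (n : WithTop ℤ) ≤ S.nu (x⁻¹ * y - 1)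
    rw [← inv_mul_cancel₀ hx0, ← mul_sub]
    exact S.le_nu_mul (S.nu_inv_of_nu_eq_zero hx).ge hxy
  rw [← mul_inv_cancel_left₀ hx0 y, hχ.1 x _ hx0 (mul_ne_zero (inv_ne_zero hx0) hy0),
    htriv _ hmem, mul_one]

lemma nu_diag_eq_zero {S : USetting E} {k : Mat E} (hk : k ∈ Kset S)
    (h10 : 1 ≤ S.nu (k 1 0)) : S.nu (k 0 0) = 0 ∧ S.nu (k 1 1) = 0 := by
  have hdet := hk.2.2
  rw [Matrix.det_fin_two] at hdet
  exact S.nu_eq_zero_of_mul_sub (hk.2.1 _ _) (hk.2.1 _ _) (S.le_nu_mul (hk.2.1 _ _) h10) hdet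

open Classical in
/-- The function supported on `𝓑 K_n`, with value `χ(k₁₁)` at `k`. -/
def cellFun (S : USetting E) (χ : E → ℂ) (n : ℤ) (k : Mat E) : ℂ :=
  if k ∈ Kset S ∧ (n : WithTop ℤ) ≤ S.nu (k 1 0) then χ (k 0 0) else 0

lemma cellFun_mem_Vsp {S : USetting E} {χ : E → ℂ} (hχ : IsChar χ) {n : ℤ} (hn : 1 ≤ n)
    (htriv : TrivOn χ (onePE S n)) : cellFun S χ n ∈ Vsp S χ n := by
  have hn' : (1 : WithTop ℤ) ≤ n := by exact_mod_cast hn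
  refine ⟨fun x hx => if_neg fun h => hx h.1, fun b hb k hk => ?_, fun k hk g hg => ?_⟩
  · have hbu := nu_diag_eq_zero hb.1 (by simp [hb.2, S.nu_zero])
    have hbk := mul_mem_Kset hb.1 hk
    have h10 : (b * k) 1 0 = b 1 1 * k 1 0 := by
      simp [Matrix.mul_apply, Fin.sum_univ_two, hb.2]
    have h00 : (b * k) 0 0 = b 0 0 * k 0 0 + b 0 1 * k 1 0 := by
      simp [Matrix.mul_apply, Fin.sum_univ_two]
    simp only [cellFun, hbk, hk, true_and, h10, S.nu_mul, hbu.2, zero_add, mul_ite, mul_zero]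
    refine if_ctx_congr Iff.rfl (fun h => ?_) fun _ => rfl
    have hku := nu_diag_eq_zero hk (hn'.trans h)
    rw [h00, ← hχ.1 _ _ (S.ne_zero_of_nu_eq_zero hbu.1) (S.ne_zero_of_nu_eq_zero hku.1)]
    refine char_congr hχ hn htriv (by rw [S.nu_mul, hbu.1, hku.1, add_zero]) ?_
    rw [add_sub_cancel_left]
    exact S.le_nu_mul (hb.1.2.1 _ _) h
  · have hkg := mul_mem_Kset hk hg.1
    have hg10 : (n : WithTop ℤ) ≤ S.nu (g 1 0) := by simpa using hg.2 1 0
    have hg00 : (n : WithTop ℤ) ≤ S.nu (g 0 0 - 1) := by simpa using hg.2 0 0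
    have hgu := nu_diag_eq_zero hg.1 (hn'.trans hg10)
    have h10 : (k * g) 1 0 = g 0 0 * k 1 0 + k 1 1 * g 1 0 := by
      simp [Matrix.mul_apply, Fin.sum_univ_two, mul_comm]
    have h00 : (k * g) 0 0 - k 0 0 = k 0 0 * (g 0 0 - 1) + k 0 1 * g 1 0 := by
      simp only [Matrix.mul_apply, Fin.sum_univ_two]
      ring
    have hkg10 := S.le_nu_mul (hk.2.1 1 1) hg10
    have hiff : (n : WithTop ℤ) ≤ S.nu ((k * g) 1 0) ↔ (n : WithTop ℤ) ≤ S.nu (k 1 0) := by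
      rw [h10]
      refine ⟨fun h => ?_, fun h => S.le_nu_add (S.le_nu_mul hgu.1.ge h) hkg10⟩
      have := S.le_nu_sub h hkg10
      rwa [add_sub_cancel_right, S.nu_mul, hgu.1, zero_add] at this
    simp only [cellFun, hkg, hk, true_and]
    refine if_ctx_congr hiff (fun h => ?_) fun _ => rfl
    refine char_congr hχ hn htriv (nu_diag_eq_zero hk (hn'.trans h)).1 ?_
    rw [h00]
    exact S.le_nu_add (S.le_nu_mul (hk.2.1 _ _) hg00) (S.le_nu_mul (hk.2.1 _ _) hg10)

lemma nu_pi_pow (S : USetting E) (d : ℕ) : S.nu (S.pi ^ d) = ((d : ℤ) : WithTop ℤ) := by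
  induction d with
  | zero => simp [S.nu_one]
  | succ d ih => rw [pow_succ, S.nu_mul, ih, S.nu_pi]; norm_cast

/-- The lower unipotent element with entry `ϖ^d √ε`. -/
def lowerUnip (S : USetting E) (d : ℕ) : Mat E := !![1, 0; S.pi ^ d * S.sqeps, 1]

lemma nu_lowerUnip_entry (S : USetting E) (d : ℕ) :
    S.nu (S.pi ^ d * S.sqeps) = ((d : ℤ) : WithTop ℤ) := by
  rw [S.nu_mul, nu_pi_pow, S.nu_sqeps, add_zero]

lemma lowerUnip_mem_Kfil (S : USetting E) (d : ℕ) : lowerUnip S d ∈ Kfil S d := by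
  have hd : (0 : WithTop ℤ) ≤ ((d : ℤ) : WithTop ℤ) := by exact_mod_cast Int.natCast_nonneg d
  refine ⟨⟨?_, fun i j => ?_, ?_⟩, fun i j => ?_⟩
  · simp only [Gset, Set.mem_ofPred_eq]
    ext i j
    fin_cases i <;> fin_cases j <;>
      simp [lowerUnip, w0, Matrix.mul_apply, Fin.sum_univ_two, S.sig_sqeps, S.sig_pi]
  · fin_cases i <;> fin_cases j <;>
      simp [lowerUnip, S.nu_one, S.nu_zero, nu_lowerUnip_entry]
  · simp [lowerUnip, Matrix.det_fin_two, S.nu_one]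
  · fin_cases i <;> fin_cases j <;>
      simp [lowerUnip, S.nu_zero, nu_lowerUnip_entry]

lemma not_Vsp_succ_le {S : USetting E} {χ : E → ℂ} (hχ : IsChar χ) {d : ℕ}
    (htriv : TrivOn χ (onePE S ((d : ℤ) + 1))) : ¬ Vsp S χ ((d : ℤ) + 1) ≤ Vsp S χ d := by
  intro hle
  have h := (hle (cellFun_mem_Vsp hχ (by omega) htriv)).2.2 1 (one_mem_Kset S) _
    (lowerUnip_mem_Kfil S d)
  have h10 : ¬ (((d : ℤ) + 1 : ℤ) : WithTop ℤ) ≤ S.nu (lowerUnip S d 1 0) := by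
    change ¬ _ ≤ S.nu (S.pi ^ d * S.sqeps)
    rw [nu_lowerUnip_entry, WithTop.coe_le_coe]
    omega
  rw [one_mul, cellFun, cellFun, if_neg fun h => h10 h.2,
    if_pos ⟨one_mem_Kset S, by simp [S.nu_zero]⟩] at h
  exact hχ.2 _ (by simp) h.symm

/-- A complement `W_d` with `d` at least the depth of `χ` is not fixed by `K_d`. -/
lemma not_actsTrivially_of_Wcompl {S : USetting E} {χ : E → ℂ} (hχ : IsChar χ) {d : ℕ}
    (htriv : TrivOn χ (onePE S ((d : ℤ) + 1))) {W : Submodule ℂ (Mat E → ℂ)}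
    (hW : Wcompl S χ d W) : ¬ ActsTrivially S (Kfil S d) W := by
  intro hact
  obtain ⟨hle, -, -, hsup⟩ := hW
  refine not_Vsp_succ_le hχ htriv (hsup ▸ sup_le le_rfl fun f hf => ?_)
  exact ⟨(hle hf).1, (hle hf).2.1, fun k _ g hg => congrFun (hact g hg f hf) k⟩

lemma RepIso.actsTrivially {S : USetting E} {V W : Submodule ℂ (Mat E → ℂ)}
    (h : RepIso S V W) {A : Set (Mat E)} (hA : A ⊆ Kset S) (hV : ActsTrivially S A V) :
    ActsTrivially S A W := by
  obtain ⟨e, he, hcomm⟩ := h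
  intro g hg w hw
  obtain ⟨f, hf, rfl⟩ := he.surjOn hw
  rw [← hcomm g (hA hg) f hf, hV g hg f hf]

lemma RepIso.actsTrivially_symm {S : USetting E} {V W : Submodule ℂ (Mat E → ℂ)}
    (h : RepIso S V W) (hinv : KInvariant S V) {A : Set (Mat E)} (hA : A ⊆ Kset S)
    (hW : ActsTrivially S A W) : ActsTrivially S A V := by
  obtain ⟨e, he, hcomm⟩ := h
  intro g hg f hf
  refine he.injOn (hinv g (hA hg) f hf) hf ?_
  rw [hcomm g (hA hg) f hf, hW g hg _ (he.mapsTo hf)]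

/-- the `K`-representations `V_χ^{K_{r+1}}` and the complements `W_d`
(`d ≥ r+1`) are pairwise non-isomorphic, so the decomposition is multiplicity-free. -/
theorem stmt10 (S : USetting E) (χ : E → ℂ) (hχ : IsChar χ) (r : ℕ)
    (hr : MinDepth S χ r) (W : ℕ → Submodule ℂ (Mat E → ℂ))
    (hW : ∀ d : ℕ, r + 1 ≤ d → Wcompl S χ d (W d)) :
    (∀ d : ℕ, r + 1 ≤ d → ¬ RepIso S (Vsp S χ ((r : ℤ) + 1)) (W d)) ∧
    (∀ d d' : ℕ, r + 1 ≤ d → r + 1 ≤ d' → d ≠ d' → ¬ RepIso S (W d) (W d')) := by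
  have htriv : ∀ d : ℕ, r + 1 ≤ d → TrivOn χ (onePE S ((d : ℤ) + 1)) := fun d hd x hx =>
    hr.1.1 x ((WithTop.coe_le_coe.2 (show (r : ℤ) + 1 ≤ (d : ℤ) + 1 by omega)).trans hx)
  have hfix : ∀ (n : ℤ) (d : ℕ) (V : Submodule ℂ (Mat E → ℂ)), n ≤ d → V ≤ Vsp S χ n →
      ActsTrivially S (Kfil S d) V := fun n d V hn hV g hg f hf =>
    rho_eq_self_of_mem_Vsp (hV hf) (Kfil_anti S hn hg)
  have hsub : ∀ d : ℕ, Kfil S d ⊆ Kset S := fun d g hg => hg.1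
  refine ⟨fun d hd hiso => ?_, fun d d' hd hd' hne hiso => ?_⟩
  · exact not_actsTrivially_of_Wcompl hχ (htriv d hd) (hW d hd)
      (hiso.actsTrivially (hsub d) (hfix _ d _ (by omega) le_rfl))
  · rcases lt_or_gt_of_ne hne with h | h
    · exact not_actsTrivially_of_Wcompl hχ (htriv d' hd') (hW d' hd')
        (hiso.actsTrivially (hsub d') (hfix _ d' _ (by omega) (hW d hd).1))
    · exact not_actsTrivially_of_Wcompl hχ (htriv d hd) (hW d hd)
        (hiso.actsTrivially_symm (hW d hd).2.1 (hsub d)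
          (hfix _ d _ (by omega) (hW d' hd').1))
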